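/- arXiv:1808.08487 — 3 statements merged into one kernel-verified Lean document; each statement's English description precedes it below -/
import Mathlib

section
/- Let m ≥ 2, 1 ≤ s ≤ m, and let (f_1, …, f_s) and (g_1, …, g_s) be two (2m, s) bent vectorial functions on GF(2^{2m}). Then there exists a permutation σ of GF(2^{2m}) whose induced coordinate permutation maps the code C(f_1, …, f_s) onto the code C(g_1, …, g_s) if and only if there exists a permutation τ of GF(2^{2m}) mapping the family of supports of the minimum weight (weight 2^{2m−1} − 2^{m−1}) codewords of C(f_1, …, f_s) onto the family of supports of the minimum weight codewords of C(g_1, …, g_s). -/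
noncomputable section

/-- The finite field `GF(2^n)` is finite. -/
instance (n : ℕ) : Fintype (GaloisField 2 n) := Fintype.ofFinite _

/-- The absolute trace map from `GF(2^(2m))` to `GF(2)`. -/
def tr (m : ℕ) (x : GaloisField 2 (2*m)) : ZMod 2 :=
  Algebra.trace (ZMod 2) (GaloisField 2 (2*m)) x

/-- A Boolean function `f : GF(2^(2m)) → GF(2)` is bent if all its Walsh
transform values have absolute value `2^m`. -/
def IsBent (m : ℕ) (f : GaloisField 2 (2*m) → ZMod 2) : Prop :=
  ∀ w : GaloisField 2 (2*m),
    |∑ x : GaloisField 2 (2*m), (-1 : ℤ) ^ ((f x + tr m (w * x)).val)| = 2 ^ m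

/-- A tuple `(f 0, …, f (ℓ-1))` of Boolean functions on `GF(2^(2m))` is a
`(2m, ℓ)` bent vectorial function if every nonzero `GF(2)`-linear combination
of the `f j` is bent. -/
def IsBentVectorial (m ℓ : ℕ) (f : Fin ℓ → GaloisField 2 (2*m) → ZMod 2) : Prop :=
  ∀ a : Fin ℓ → ZMod 2, a ≠ 0 → IsBent m (fun x => ∑ j, a j * f j x)

/-- The binary linear code `C(f 0, …, f (ℓ-1))` of length `2^(2m)` (with
coordinates indexed by `GF(2^(2m))`, a codeword being a function
`GF(2^(2m)) → GF(2)`, i.e. the truth table of a Boolean function), spanned by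
the truth tables of the `f j`, the truth tables of the linear functions
`x ↦ tr (w * x)` for all `w`, and the all-one vector. -/
def code (m ℓ : ℕ) (f : Fin ℓ → GaloisField 2 (2*m) → ZMod 2) :
    Submodule (ZMod 2) (GaloisField 2 (2*m) → ZMod 2) :=
  Submodule.span (ZMod 2)
    (Set.range f ∪ Set.range (fun w => fun x => tr m (w * x)) ∪ {fun _ => (1 : ZMod 2)})

/-- The Hamming weight of a codeword: the number of nonzero coordinates. -/
def wt (m : ℕ) (c : GaloisField 2 (2*m) → ZMod 2) : ℕ :=
  {x | c x ≠ 0}.ncard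

/-- The support of a codeword: the set of coordinates where it is nonzero. -/
def supp (m : ℕ) (c : GaloisField 2 (2*m) → ZMod 2) : Set (GaloisField 2 (2*m)) :=
  {x | c x ≠ 0}

/-- The sign character of `GF(2)`. -/
def chi (a : ZMod 2) : ℤ := (-1 : ℤ) ^ a.val

lemma chi_add (a b : ZMod 2) : chi (a + b) = chi a * chi b := by
  revert a b; unfold chi; decide

lemma chi_eq (a : ZMod 2) : chi a = 1 - 2 * (if a ≠ 0 then 1 else 0) := by
  revert a; unfold chi; decide

lemma chi_zero : chi 0 = 1 := by unfold chi; decide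

lemma chi_one : chi 1 = -1 := by unfold chi; decide

lemma tr_add (m : ℕ) (x y : GaloisField 2 (2*m)) : tr m (x + y) = tr m x + tr m y := by
  simp [tr]

lemma tr_zero (m : ℕ) : tr m 0 = 0 := by simp [tr]

lemma card_gf (m : ℕ) (hm : 2 ≤ m) : Fintype.card (GaloisField 2 (2*m)) = 2 ^ (2*m) := by
  rw [← Nat.card_eq_fintype_card, GaloisField.card 2 (2*m) (by omega)]

lemma exists_tr (m : ℕ) (x : GaloisField 2 (2*m)) (hx : x ≠ 0) :
    ∃ v, tr m (v * x) = 1 := by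
  have : Algebra.IsSeparable (ZMod 2) (GaloisField 2 (2*m)) :=
    Algebra.IsAlgebraic.isSeparable_of_perfectField
  obtain ⟨y, hy⟩ := Algebra.trace_surjective (ZMod 2) (GaloisField 2 (2*m)) 1
  exact ⟨y * x⁻¹, by rw [mul_assoc, inv_mul_cancel₀ hx, mul_one]; exact hy⟩

lemma sum_chi_tr (m : ℕ) (x : GaloisField 2 (2*m)) (hx : x ≠ 0) :
    ∑ w : GaloisField 2 (2*m), chi (tr m (w * x)) = 0 := by
  obtain ⟨v, hv⟩ := exists_tr m x hx
  have h := Equiv.sum_comp (Equiv.addRight v) (fun w => chi (tr m (w * x)))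
  simp only [Equiv.coe_addRight, add_mul, tr_add, chi_add, hv, chi_one] at h
  rw [← Finset.sum_mul] at h
  linarith

/-- Walsh transform. -/
def walsh (m : ℕ) (h : GaloisField 2 (2*m) → ZMod 2) (w : GaloisField 2 (2*m)) : ℤ :=
  ∑ x : GaloisField 2 (2*m), chi (h x + tr m (w * x))

lemma sum_walsh (m : ℕ) (hm : 2 ≤ m) (h : GaloisField 2 (2*m) → ZMod 2) :
    ∑ w, walsh m h w = 2 ^ (2*m) * chi (h 0) := by
  unfold walsh
  rw [Finset.sum_comm]
  simp only [chi_add]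
  simp only [← Finset.mul_sum]
  rw [Finset.sum_eq_single 0]
  · simp only [mul_zero, tr_zero, chi_zero, Finset.sum_const, Finset.card_univ, card_gf m hm]
    simp [mul_comm]
  · intro b _ hb
    rw [sum_chi_tr m b hb, mul_zero]
  · simp

lemma sum_chi_wt (m : ℕ) (hm : 2 ≤ m) (c : GaloisField 2 (2*m) → ZMod 2) :
    ∑ x, chi (c x) = 2 ^ (2*m) - 2 * (wt m c : ℤ) := by
  classical
  have : wt m c = ∑ x, (if c x ≠ 0 then 1 else 0) := by
    unfold wt
    rw [Set.ncard_eq_toFinset_card', Finset.sum_boole]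
    simp
  rw [this]
  simp only [chi_eq]
  rw [Finset.sum_sub_distrib, ← Finset.mul_sum]
  simp [card_gf m hm]

lemma wt_of_sum (m : ℕ) (hm : 2 ≤ m) (c : GaloisField 2 (2*m) → ZMod 2)
    (h : ∑ x, chi (c x) = 2 ^ m) : wt m c = 2^(2*m-1) - 2^(m-1) := by
  rw [sum_chi_wt m hm] at h
  have h1 : 2 ^ (2*m) = 2 * 2 ^ (2*m-1) := by
    rw [← pow_succ']; congr 1; omega
  have h2 : 2 ^ m = 2 * 2 ^ (m-1) := by
    rw [← pow_succ']; congr 1; omega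
  have h3 : (2:ℤ) ^ (2*m) = 2 * 2 ^ (2*m-1) := by exact_mod_cast h1
  have h4 : (2:ℤ) ^ m = 2 * 2 ^ (m-1) := by exact_mod_cast h2
  rw [h3, h4] at h
  have h5 : wt m c + 2 ^ (m-1) = 2 ^ (2*m-1) := by
    zify; linarith
  omega

/-- Minimum weight codewords. -/
def minWords (m s : ℕ) (f : Fin s → GaloisField 2 (2*m) → ZMod 2) :
    Set (GaloisField 2 (2*m) → ZMod 2) :=
  {c | c ∈ code m s f ∧ wt m c = 2^(2*m-1) - 2^(m-1)}

lemma lin_mem (m s : ℕ) (f : Fin s → GaloisField 2 (2*m) → ZMod 2) (w) :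
    (fun x => tr m (w * x)) ∈ code m s f :=
  Submodule.subset_span (Or.inl (Or.inr ⟨w, rfl⟩))

lemma const_mem (m s : ℕ) (f : Fin s → GaloisField 2 (2*m) → ZMod 2) (b : ZMod 2) :
    (fun _ => b) ∈ code m s f := by
  have h : (fun _ => (1 : ZMod 2)) ∈ code m s f := Submodule.subset_span (Or.inr rfl)
  have := (code m s f).smul_mem b h
  convert this using 1
  ext x; simp

lemma key (m s : ℕ) (hm : 2 ≤ m) (f : Fin s → GaloisField 2 (2*m) → ZMod 2)
    (h : GaloisField 2 (2*m) → ZMod 2) (hh : IsBent m h) (hc : h ∈ code m s f)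
    (w : GaloisField 2 (2*m)) :
    ∃ b : ZMod 2, walsh m h w = 2 ^ m * chi b ∧
      (fun x => h x + tr m (w * x) + b) ∈ minWords m s f := by
  have hmem : ∀ b : ZMod 2, (fun x => h x + tr m (w * x) + b) ∈ code m s f := fun b =>
    (code m s f).add_mem ((code m s f).add_mem hc (lin_mem m s f w)) (const_mem m s f b)
  have h1 : |walsh m h w| = 2 ^ m := hh w
  have h2 : ∃ b : ZMod 2, walsh m h w = 2 ^ m * chi b := by
    rcases (abs_eq (by positivity)).1 h1 with h1 | h1
    · exact ⟨0, by rw [h1, chi_zero, mul_one]⟩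
    · exact ⟨1, by rw [h1, chi_one]; ring⟩
  obtain ⟨b, hb⟩ := h2
  refine ⟨b, hb, hmem b, wt_of_sum m hm _ ?_⟩
  have hbb : chi b * chi b = 1 := by clear hb; revert b; unfold chi; decide
  simp only [chi_add _ b]
  rw [← Finset.sum_mul]
  change walsh m h w * chi b = _
  rw [hb, mul_assoc, hbb, mul_one]

lemma one_mem (m s : ℕ) (hm : 2 ≤ m) (f : Fin s → GaloisField 2 (2*m) → ZMod 2)
    (h : GaloisField 2 (2*m) → ZMod 2) (hh : IsBent m h) (hc : h ∈ code m s f) :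
    (fun _ => (1 : ZMod 2)) ∈ Submodule.span (ZMod 2) (minWords m s f) := by
  by_contra hD
  set D := Submodule.span (ZMod 2) (minWords m s f) with hDdef
  choose b hb hbm using key m s hm f h hh hc
  have hbD : ∀ w, (fun x => h x + tr m (w * x) + b w) ∈ D :=
    fun w => Submodule.subset_span (hbm w)
  have hcz : ∀ t : ZMod 2, (fun _ => t) ∈ D → t = 0 := by
    intro t ht
    have h2 : t = 0 ∨ t = 1 := by clear ht; revert t; decide
    rcases h2 with h2 | h2
    · exact h2
    · subst h2; exact absurd ht hD
  have hadd : ∀ v w, b v + b w + b (v + w) + b 0 = 0 := by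
    intro v w
    apply hcz
    have := D.add_mem (D.add_mem (D.add_mem (hbD v) (hbD w)) (hbD (v + w))) (hbD 0)
    convert this using 1
    ext x
    simp only [Pi.add_apply, add_mul, tr_add, zero_mul, tr_zero]
    have e : ∀ p q r t u k l : ZMod 2, t + u + k + l =
      p + q + t + (p + r + u) + (p + (q + r) + k) + (p + 0 + l) := by decide
    exact e _ _ _ _ _ _ _
  have hmul : ∀ v w, walsh m h (w + v) * walsh m h 0 = walsh m h w * walsh m h v := by
    intro v w
    have e : b (w + v) + b 0 = b w + b v := by
      have := hadd w v
      revert this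
      generalize b (w + v) = p
      generalize b 0 = q
      generalize b w = r
      generalize b v = t
      revert p q r t; decide
    have := congrArg chi e
    rw [chi_add, chi_add] at this
    rw [hb, hb, hb, hb]
    linear_combination (2 ^ m * 2 ^ m) * this
  have hS := sum_walsh m hm h
  set S := ∑ w, walsh m h w with hSdef
  have hchi : ∀ t, |chi t| = 1 := by unfold chi; decide
  have hSabs : |S| = 2 ^ (2*m) := by
    rw [hS, abs_mul, hchi, mul_one, abs_of_pos (by positivity)]
  have hSne : S ≠ 0 := by
    intro h0; rw [h0, abs_zero] at hSabs
    have : (0:ℤ) < 2 ^ (2*m) := by positivity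
    omega
  have hcst : ∀ v, walsh m h v = walsh m h 0 := by
    intro v
    have h1 : S * walsh m h 0 = S * walsh m h v := by
      conv_lhs => rw [hSdef, ← Equiv.sum_comp (Equiv.addRight v)]
      rw [hSdef, Finset.sum_mul, Finset.sum_mul]
      exact Finset.sum_congr rfl (fun w _ => hmul v w)
    exact (mul_left_cancel₀ hSne h1).symm
  have hS2 : S = 2 ^ (2*m) * walsh m h 0 := by
    rw [hSdef, Finset.sum_congr rfl (fun w _ => hcst w)]
    simp [card_gf m hm]
  have hw0 : |walsh m h 0| = 2 ^ m := hh 0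
  rw [hS2, abs_mul, hw0, abs_of_pos (by positivity)] at hSabs
  have hp : (0:ℤ) < 2 ^ (2*m) := by positivity
  have h1m : (1:ℤ) < 2 ^ m := one_lt_pow₀ (by norm_num) (by omega)
  nlinarith

lemma bent_mem (m s : ℕ) (hm : 2 ≤ m) (f : Fin s → GaloisField 2 (2*m) → ZMod 2)
    (h : GaloisField 2 (2*m) → ZMod 2) (hh : IsBent m h) (hc : h ∈ code m s f)
    (w : GaloisField 2 (2*m)) :
    (fun x => h x + tr m (w * x)) ∈ Submodule.span (ZMod 2) (minWords m s f) := by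
  obtain ⟨b, -, hb⟩ := key m s hm f h hh hc w
  have h1 := Submodule.smul_mem _ b (one_mem m s hm f h hh hc)
  have := Submodule.add_mem _ (Submodule.subset_span hb) h1
  convert this using 1
  ext x
  simp only [Pi.add_apply, Pi.smul_apply, smul_eq_mul, mul_one]
  have e : ∀ p q r : ZMod 2, p + q = p + q + r + r := by decide
  exact e _ _ _

lemma span_minWords (m s : ℕ) (hm : 2 ≤ m) (hs1 : 1 ≤ s)
    (f : Fin s → GaloisField 2 (2*m) → ZMod 2) (hf : IsBentVectorial m s f) :
    Submodule.span (ZMod 2) (minWords m s f) = code m s f := by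
  apply le_antisymm
  · exact Submodule.span_le.2 (fun c hc => hc.1)
  have hfb : ∀ j, IsBent m (f j) := by
    intro j
    have := hf (Pi.single j 1) (by simp)
    convert this using 2 with x
    rw [Finset.sum_eq_single j]
    · simp
    · intro i _ hi; simp [Pi.single_eq_of_ne hi]
    · simp
  have hfc : ∀ j, f j ∈ code m s f := fun j => Submodule.subset_span (Or.inl (Or.inl ⟨j, rfl⟩))
  have hfD : ∀ j, f j ∈ Submodule.span (ZMod 2) (minWords m s f) := by
    intro j
    have := bent_mem m s hm f (f j) (hfb j) (hfc j) 0
    simpa [tr_zero] using this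
  conv_lhs => unfold code
  refine Submodule.span_le.2 ?_
  rintro c ((⟨j, rfl⟩ | ⟨w, rfl⟩) | hc)
  · exact hfD j
  · let j : Fin s := ⟨0, hs1⟩
    have := Submodule.sub_mem _ (bent_mem m s hm f (f j) (hfb j) (hfc j) w) (hfD j)
    have e : (fun x => tr m (w * x)) = (fun x => f j x + tr m (w * x)) - f j := by
      ext x; simp
    rw [← e] at this
    exact this
  · rw [Set.mem_singleton_iff.1 hc]
    exact one_mem m s hm f (f ⟨0, hs1⟩) (hfb _) (hfc _)

lemma supp_comp (m : ℕ) (σ : Equiv.Perm (GaloisField 2 (2*m)))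
    (c : GaloisField 2 (2*m) → ZMod 2) : supp m (c ∘ σ) = σ.symm '' supp m c := by
  rw [Equiv.image_symm_eq_preimage]; rfl

lemma wt_comp (m : ℕ) (σ : Equiv.Perm (GaloisField 2 (2*m)))
    (c : GaloisField 2 (2*m) → ZMod 2) : wt m (c ∘ σ) = wt m c := by
  change (supp m (c ∘ σ)).ncard = (supp m c).ncard
  rw [supp_comp, Set.ncard_image_of_injective _ σ.symm.injective]

lemma supp_inj (m : ℕ) : Function.Injective (supp m) := by
  intro c d h
  ext1 x
  have : x ∈ supp m c ↔ x ∈ supp m d := by rw [h]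
  simp only [supp, Set.mem_setOf_eq] at this
  revert this
  generalize c x = p
  generalize d x = q
  revert p q; decide

lemma blocks_eq (m s : ℕ) (f : Fin s → GaloisField 2 (2*m) → ZMod 2) :
    {S | ∃ c ∈ code m s f, wt m c = 2^(2*m-1) - 2^(m-1) ∧ S = supp m c} =
      supp m '' minWords m s f := by
  ext S
  constructor
  · rintro ⟨c, h1, h2, rfl⟩; exact ⟨c, ⟨h1, h2⟩, rfl⟩
  · rintro ⟨c, ⟨h1, h2⟩, rfl⟩; exact ⟨c, h1, h2, rfl⟩

lemma image_blocks (m : ℕ) (σ : Equiv.Perm (GaloisField 2 (2*m)))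
    (A : Set (GaloisField 2 (2*m) → ZMod 2)) :
    (fun S => σ.symm '' S) '' (supp m '' A) = supp m '' ((fun c => c ∘ σ) '' A) := by
  rw [Set.image_image, Set.image_image]
  simp only [supp_comp]

lemma image_minWords (m s : ℕ) (f g : Fin s → GaloisField 2 (2*m) → ZMod 2)
    (σ : Equiv.Perm (GaloisField 2 (2*m)))
    (h : (fun c => c ∘ σ) '' (code m s f : Set (GaloisField 2 (2*m) → ZMod 2)) =
          (code m s g : Set (GaloisField 2 (2*m) → ZMod 2))) :
    (fun c => c ∘ σ) '' minWords m s f = minWords m s g := by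
  ext d
  constructor
  · rintro ⟨c, ⟨h1, h2⟩, rfl⟩
    refine ⟨?_, by rw [← h2]; exact wt_comp m σ c⟩
    have : c ∘ σ ∈ (code m s g : Set (GaloisField 2 (2*m) → ZMod 2)) := h ▸ ⟨c, h1, rfl⟩
    exact this
  · rintro ⟨h1, h2⟩
    have h1' : d ∈ (code m s g : Set (GaloisField 2 (2*m) → ZMod 2)) := h1
    rw [← h] at h1'
    obtain ⟨c, hc, rfl⟩ := h1'
    exact ⟨c, ⟨hc, by rw [← h2]; exact (wt_comp m σ c).symm⟩, rfl⟩


/-- two codes obtained from bent vectorial functions are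
equivalent iff the designs supported by their minimum weight codewords are
isomorphic. -/
theorem stmt_6 (m s : ℕ) (hm : 2 ≤ m) (hs1 : 1 ≤ s) (hsm : s ≤ m)
    (f g : Fin s → GaloisField 2 (2*m) → ZMod 2)
    (hf : IsBentVectorial m s f) (hg : IsBentVectorial m s g) :
    (∃ σ : Equiv.Perm (GaloisField 2 (2*m)),
        (fun c => c ∘ σ) '' (code m s f : Set (GaloisField 2 (2*m) → ZMod 2)) =
          (code m s g : Set (GaloisField 2 (2*m) → ZMod 2))) ↔
    (∃ τ : Equiv.Perm (GaloisField 2 (2*m)),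
        (fun S => τ '' S) ''
            {S | ∃ c ∈ code m s f, wt m c = 2^(2*m-1) - 2^(m-1) ∧ S = supp m c} =
          {S | ∃ c ∈ code m s g, wt m c = 2^(2*m-1) - 2^(m-1) ∧ S = supp m c}) := by
  simp only [blocks_eq]
  constructor
  · rintro ⟨σ, h⟩
    exact ⟨σ.symm, by rw [image_blocks, image_minWords m s f g σ h]⟩
  · rintro ⟨τ, h⟩
    have h' := image_blocks m τ.symm (minWords m s f)
    rw [Equiv.symm_symm, h] at h'
    have h2 := (Set.image_injective.2 (supp_inj m)) h'
    refine ⟨τ.symm, ?_⟩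
    rw [← span_minWords m s hm hs1 f hf, ← span_minWords m s hm hs1 g hg, h2]
    have := Submodule.map_span
      (LinearMap.funLeft (ZMod 2) (ZMod 2) (τ.symm : GaloisField 2 (2*m) → GaloisField 2 (2*m)))
      (minWords m s f)
    exact congrArg (fun P : Submodule (ZMod 2) (GaloisField 2 (2*m) → ZMod 2) =>
      (P : Set (GaloisField 2 (2*m) → ZMod 2))) this
end
end

section
/- Let m ≥ 2, 1 ≤ ℓ ≤ m, and let (f_1, …, f_ℓ) be a (2m, ℓ) bent vectorial function on GF(2^{2m}). Then the dual code of C(f_1, …, f_ℓ), namely the set of all vectors of GF(2)^{2^{2m}} orthogonal (under the standard bilinear form) to every codeword of C(f_1, …, f_ℓ), has minimum Hamming weight exactly 4 among its nonzero vectors. -/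
noncomputable section

/-- the dual code of `C(f_1, …, f_ℓ)` has minimum Hamming
weight exactly 4 among its nonzero vectors. -/
theorem stmt_11 (m ℓ : ℕ) (hm : 2 ≤ m) (hℓ1 : 1 ≤ ℓ) (hℓm : ℓ ≤ m)
    (f : Fin ℓ → GaloisField 2 (2*m) → ZMod 2) (hf : IsBentVectorial m ℓ f) :
    (∃ d : GaloisField 2 (2*m) → ZMod 2,
      (∀ c ∈ code m ℓ f, ∑ x : GaloisField 2 (2*m), d x * c x = 0) ∧
      d ≠ 0 ∧ wt m d = 4) ∧
    (∀ d : GaloisField 2 (2*m) → ZMod 2,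
      (∀ c ∈ code m ℓ f, ∑ x : GaloisField 2 (2*m), d x * c x = 0) →
      d ≠ 0 → 4 ≤ wt m d) := by
  classical
  constructor
  · obtain ⟨v, hv⟩ := Fintype.exists_lt_card_fiber_of_mul_lt_card (n := 2)
      (fun (x : GaloisField 2 (2*m)) (j : Fin ℓ) => f j x + f j (x + 1)) (by
        have hc : Fintype.card (GaloisField 2 (2*m)) = 2 ^ (2*m) := by
          rw [← Nat.card_eq_fintype_card]
          exact GaloisField.card 2 (2*m) (by omega)
        rw [hc]
        simp only [Fintype.card_pi, ZMod.card, Finset.prod_const, Finset.card_univ,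
          Fintype.card_fin]
        calc 2 ^ ℓ * 2 = 2 ^ (ℓ + 1) := by ring
          _ < 2 ^ (2*m) := Nat.pow_lt_pow_right (by norm_num) (by omega))
    obtain ⟨x, hx⟩ := Finset.card_pos.mp (lt_trans (by norm_num) hv)
    obtain ⟨y, hy, hyn⟩ : ∃ y ∈ Finset.univ.filter (fun (x : GaloisField 2 (2*m)) =>
        (fun (j : Fin ℓ) => f j x + f j (x + 1)) = v),
        y ∉ ({x, x + 1} : Finset (GaloisField 2 (2*m))) := by
      by_contra! h
      have h1 := Finset.card_le_card (Finset.subset_iff.mpr h)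
      have h2 := Finset.card_le_two (a := x) (b := x + 1)
      omega
    simp only [Finset.mem_filter, Finset.mem_univ, true_and] at hx hy
    simp only [Finset.mem_insert, Finset.mem_singleton, not_or] at hyn
    obtain ⟨hyx, hyx1⟩ := hyn
    have h11 : (1 : GaloisField 2 (2*m)) + 1 = 0 := CharTwo.add_self_eq_zero 1
    have h10 : (1 : GaloisField 2 (2*m)) ≠ 0 := one_ne_zero
    have e1 : x ≠ x + 1 := by simp
    have e2 : y ≠ y + 1 := by simp
    have e3 : x ≠ y + 1 := by
      rintro rfl
      apply hyx1
      rw [add_assoc, h11, add_zero]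
    have e4 : x + 1 ≠ y + 1 := by
      intro h
      exact hyx (add_right_cancel h).symm
    let S : Finset (GaloisField 2 (2*m)) := {x, x + 1, y, y + 1}
    have hS : ∀ g : GaloisField 2 (2*m) → ZMod 2,
        ∑ z, (if z ∈ S then (1 : ZMod 2) else 0) * g z = g x + g (x + 1) + (g y + g (y + 1)) := by
      intro g
      simp only [ite_mul, one_mul, zero_mul, Finset.sum_ite_mem, Finset.univ_inter]
      rw [Finset.sum_insert (by simp [e1, Ne.symm hyx, e3]),
        Finset.sum_insert (by simp [Ne.symm hyx1, e4]), Finset.sum_pair e2, add_assoc]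
    have hcard : S.card = 4 := by
      rw [Finset.card_insert_of_notMem (by simp [e1, Ne.symm hyx, e3]),
        Finset.card_insert_of_notMem (by simp [Ne.symm hyx1, e4]), Finset.card_pair e2]
    refine ⟨fun z => if z ∈ S then 1 else 0, ?_, ?_, ?_⟩
    · intro c hc
      rw [hS c]
      induction hc using Submodule.span_induction with
      | mem c hc =>
        rcases hc with (⟨j, rfl⟩ | ⟨w, rfl⟩) | rfl
        · have h1 := congrFun hx j
          have h2 := congrFun hy j
          rw [h1, h2]
          exact CharTwo.add_self_eq_zero _
        · simp only [tr, mul_add, map_add]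
          generalize (Algebra.trace (ZMod 2) (GaloisField 2 (2*m))) (w * x) = a
          generalize (Algebra.trace (ZMod 2) (GaloisField 2 (2*m))) (w * y) = b
          generalize (Algebra.trace (ZMod 2) (GaloisField 2 (2*m))) (w * 1) = c
          revert a b c
          decide
        · exact (by decide : (1 : ZMod 2) + 1 + (1 + 1) = 0)
      | zero => simp
      | add c d _ _ h1 h2 =>
        simp only [Pi.add_apply]
        linear_combination h1 + h2
      | smul a c _ h =>
        simp only [Pi.smul_apply, smul_eq_mul]
        linear_combination a * h
    · intro h
      have := congrFun h x
      simp [S] at this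
    · have : {z | (fun z => if z ∈ S then (1 : ZMod 2) else 0) z ≠ 0}
          = (S : Set (GaloisField 2 (2*m))) := by
        ext z
        simp
      rw [wt, this, Set.ncard_coe_finset, hcard]
  · intro d hd hd0
    by_contra! hlt
    let S : Finset (GaloisField 2 (2*m)) := Finset.univ.filter (fun x => d x ≠ 0)
    have hSc : S.card < 4 := by
      have : {x | d x ≠ 0} = (S : Set (GaloisField 2 (2*m))) := by
        ext z
        simp [S]
      rwa [wt, this, Set.ncard_coe_finset] at hlt
    have hz2 : ∀ a : ZMod 2, a ≠ 0 → a = 1 := by decide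
    have hsum : ∀ g : GaloisField 2 (2*m) → ZMod 2, ∑ x, d x * g x = ∑ x ∈ S, g x := by
      intro g
      rw [Finset.sum_filter]
      refine Finset.sum_congr rfl fun x _ => ?_
      split_ifs with h
      · rw [hz2 _ h, one_mul]
      · rw [not_not.mp h, zero_mul]
    have h1 : ((S.card : ℕ) : ZMod 2) = 0 := by
      have := hd (fun _ => 1) (Submodule.subset_span (Or.inr rfl))
      rw [hsum] at this
      simpa using this
    have hpos : 0 < S.card := by
      obtain ⟨x, hx⟩ := Function.ne_iff.mp hd0
      exact Finset.card_pos.mpr ⟨x, by simpa [S] using hx⟩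
    have h2 : S.card = 2 := by
      rw [ZMod.natCast_eq_zero_iff] at h1
      omega
    obtain ⟨x, y, hxy, hSxy⟩ := Finset.card_eq_two.mp h2
    apply hxy
    have h3 : ∀ w, Algebra.trace (ZMod 2) (GaloisField 2 (2*m)) ((x + y) * w) = 0 := by
      intro w
      have := hd (fun x => tr m (w * x)) (Submodule.subset_span (Or.inl (Or.inr ⟨w, rfl⟩)))
      rw [hsum, hSxy, Finset.sum_pair hxy] at this
      rw [add_mul, map_add, mul_comm x, mul_comm y]
      exact this
    have h4 : x + y = 0 := by
      haveI : Algebra.IsAlgebraic (ZMod 2) (GaloisField 2 (2*m)) :=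
        Algebra.IsAlgebraic.of_finite _ _
      haveI : Algebra.IsSeparable (ZMod 2) (GaloisField 2 (2*m)) :=
        Algebra.IsAlgebraic.isSeparable_of_perfectField
      exact (traceForm_nondegenerate (ZMod 2) (GaloisField 2 (2*m))).1 _
        (fun w => by rw [Algebra.traceForm_apply]; exact h3 w)
    exact CharTwo.add_eq_zero.mp h4
end
end

section
/- Let (f_1, f_2) and (g_1, g_2) be any two (4, 2) bent vectorial functions on GF(2^4). Then the binary linear [16, 7, 6] codes C(f_1, f_2) and C(g_1, g_2) are equivalent; that is, there exists a permutation σ of GF(2^4) whose induced coordinate permutation maps C(f_1, f_2) onto C(g_1, g_2). -/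
noncomputable section

/-- Quadratic form with given coefficients. -/
def qf (a b c d e f x y z t : ZMod 2) : ZMod 2 :=
  a*x*y + b*x*z + c*x*t + d*y*z + e*y*t + f*z*t

/-- Polar form of `qf`. -/
def bf (a b c d e f x y z t x' y' z' t' : ZMod 2) : ZMod 2 :=
  a*(x*y'+y*x') + b*(x*z'+z*x') + c*(x*t'+t*x') + d*(y*z'+z*y') + e*(y*t'+t*y') + f*(z*t'+t*z')

/-- Pfaffian. -/
def pf (a b c d e f : ZMod 2) : ZMod 2 := a*f+b*e+c*d

/-- sign -/
def sg (x : ZMod 2) : ℤ := (-1)^x.val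

/-- Sum over four bits. -/
def S4 (G : ZMod 2 → ZMod 2 → ZMod 2 → ZMod 2 → ℤ) : ℤ :=
  ((G 0 0 0 0 + G 0 0 0 1) + (G 0 0 1 0 + G 0 0 1 1)) + ((G 0 1 0 0 + G 0 1 0 1) + (G 0 1 1 0 + G 0 1 1 1))
  + (((G 1 0 0 0 + G 1 0 0 1) + (G 1 0 1 0 + G 1 0 1 1)) + ((G 1 1 0 0 + G 1 1 0 1) + (G 1 1 1 0 + G 1 1 1 1)))

def Bent4 (G : ZMod 2 → ZMod 2 → ZMod 2 → ZMod 2 → ZMod 2) : Prop :=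
  ∀ l m n k : ZMod 2, |S4 fun x y z t => sg (G x y z t + (l*x+m*y+n*z+k*t))| = 4

lemma pf_of_sum : ∀ u a b c d e f : ZMod 2,
    |S4 fun x y z t => sg (qf a b c d e f x y z t + u)| = 4 → pf a b c d e f = 1 := by
  decide +kernel

/-- Boolean version of `bf`. -/
def bfB (a b c d e f x y z t x' y' z' t' : Bool) : Bool :=
  xor (xor (xor (xor (xor (a && xor (x && y') (y && x')) (b && xor (x && z') (z && x')))
    (c && xor (x && t') (t && x'))) (d && xor (y && z') (z && y')))
    (e && xor (y && t') (t && y'))) (f && xor (z && t') (t && z'))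

/-- Boolean version of `pf`. -/
def pfB (a b c d e f : Bool) : Bool := xor (xor (a && f) (b && e)) (c && d)

/-- Bits as elements of `ZMod 2`. -/
def bit2 : Bool → ZMod 2
  | true => 1
  | false => 0

lemma bit2_surj : ∀ x : ZMod 2, ∃ b, bit2 b = x := by decide
lemma bit2_add : ∀ x y, bit2 x + bit2 y = bit2 (xor x y) := by decide
lemma bit2_mul : ∀ x y, bit2 x * bit2 y = bit2 (x && y) := by decide
lemma bit2_one : ∀ x, bit2 x = 1 ↔ x = true := by decide
lemma bit2_zero : ∀ x, bit2 x = 0 ↔ x = false := by decide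

lemma bf_bit2 (a b c d e f x y z t x' y' z' t' : Bool) :
    bf (bit2 a) (bit2 b) (bit2 c) (bit2 d) (bit2 e) (bit2 f) (bit2 x) (bit2 y) (bit2 z) (bit2 t)
      (bit2 x') (bit2 y') (bit2 z') (bit2 t') = bit2 (bfB a b c d e f x y z t x' y' z' t') := by
  simp only [bf, bfB, bit2_add, bit2_mul]

lemma bf_bit2' (a b c d e f x' y' z' t' : Bool) :
    bf (bit2 a) (bit2 b) (bit2 c) (bit2 d) (bit2 e) (bit2 f) 1 0 0 0
      (bit2 x') (bit2 y') (bit2 z') (bit2 t') =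
      bit2 (bfB a b c d e f true false false false x' y' z' t') :=
  bf_bit2 a b c d e f true false false false x' y' z' t'

lemma pf_bit2 (a b c d e f : Bool) :
    pf (bit2 a) (bit2 b) (bit2 c) (bit2 d) (bit2 e) (bit2 f) = bit2 (pfB a b c d e f) := by
  simp only [pf, pfB, bit2_add, bit2_mul]

lemma exists_basis_bool : ∀ a b c d e f : Bool, pfB a b c d e f = true →
    ∀ a' b' c' d' e' f' : Bool, pfB a' b' c' d' e' f' = true →
    pfB (xor a a') (xor b b') (xor c c') (xor d d') (xor e e') (xor f f') = true →
    ∃ r₀ r₁ r₂ r₃ : Bool,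
      (bfB a b c d e f true false false false r₀ r₁ r₂ r₃ = true ∧ bfB a' b' c' d' e' f' true false false false r₀ r₁ r₂ r₃ = false) ∧
    ∃ s₀ s₁ s₂ s₃ : Bool,
      (bfB a b c d e f true false false false s₀ s₁ s₂ s₃ = false ∧ bfB a' b' c' d' e' f' true false false false s₀ s₁ s₂ s₃ = true ∧
      bfB a b c d e f r₀ r₁ r₂ r₃ s₀ s₁ s₂ s₃ = false ∧ bfB a' b' c' d' e' f' r₀ r₁ r₂ r₃ s₀ s₁ s₂ s₃ = false) ∧
    ∃ q₀ q₁ q₂ q₃ : Bool,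
      bfB a b c d e f true false false false q₀ q₁ q₂ q₃ = false ∧ bfB a' b' c' d' e' f' true false false false q₀ q₁ q₂ q₃ = false ∧
      bfB a b c d e f q₀ q₁ q₂ q₃ r₀ r₁ r₂ r₃ = false ∧ bfB a' b' c' d' e' f' q₀ q₁ q₂ q₃ r₀ r₁ r₂ r₃ = true ∧
      bfB a b c d e f q₀ q₁ q₂ q₃ s₀ s₁ s₂ s₃ = true ∧ bfB a' b' c' d' e' f' q₀ q₁ q₂ q₃ s₀ s₁ s₂ s₃ = true := by
  decide +kernel

lemma exists_basis : ∀ a b c d e f : ZMod 2, pf a b c d e f = 1 →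
    ∀ a' b' c' d' e' f' : ZMod 2, pf a' b' c' d' e' f' = 1 →
    pf (a+a') (b+b') (c+c') (d+d') (e+e') (f+f') = 1 →
    ∃ r₀ r₁ r₂ r₃ : ZMod 2,
      (bf a b c d e f 1 0 0 0 r₀ r₁ r₂ r₃ = 1 ∧ bf a' b' c' d' e' f' 1 0 0 0 r₀ r₁ r₂ r₃ = 0) ∧
    ∃ s₀ s₁ s₂ s₃ : ZMod 2,
      (bf a b c d e f 1 0 0 0 s₀ s₁ s₂ s₃ = 0 ∧ bf a' b' c' d' e' f' 1 0 0 0 s₀ s₁ s₂ s₃ = 1 ∧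
      bf a b c d e f r₀ r₁ r₂ r₃ s₀ s₁ s₂ s₃ = 0 ∧ bf a' b' c' d' e' f' r₀ r₁ r₂ r₃ s₀ s₁ s₂ s₃ = 0) ∧
    ∃ q₀ q₁ q₂ q₃ : ZMod 2,
      bf a b c d e f 1 0 0 0 q₀ q₁ q₂ q₃ = 0 ∧ bf a' b' c' d' e' f' 1 0 0 0 q₀ q₁ q₂ q₃ = 0 ∧
      bf a b c d e f q₀ q₁ q₂ q₃ r₀ r₁ r₂ r₃ = 0 ∧ bf a' b' c' d' e' f' q₀ q₁ q₂ q₃ r₀ r₁ r₂ r₃ = 1 ∧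
      bf a b c d e f q₀ q₁ q₂ q₃ s₀ s₁ s₂ s₃ = 1 ∧ bf a' b' c' d' e' f' q₀ q₁ q₂ q₃ s₀ s₁ s₂ s₃ = 1 := by
  intro a b c d e f h a' b' c' d' e' f' h' h''
  obtain ⟨a, rfl⟩ := bit2_surj a
  obtain ⟨b, rfl⟩ := bit2_surj b
  obtain ⟨c, rfl⟩ := bit2_surj c
  obtain ⟨d, rfl⟩ := bit2_surj d
  obtain ⟨e, rfl⟩ := bit2_surj e
  obtain ⟨f, rfl⟩ := bit2_surj f
  obtain ⟨a', rfl⟩ := bit2_surj a'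
  obtain ⟨b', rfl⟩ := bit2_surj b'
  obtain ⟨c', rfl⟩ := bit2_surj c'
  obtain ⟨d', rfl⟩ := bit2_surj d'
  obtain ⟨e', rfl⟩ := bit2_surj e'
  obtain ⟨f', rfl⟩ := bit2_surj f'
  simp only [bit2_add, pf_bit2, bit2_one] at h h' h''
  obtain ⟨r₀, r₁, r₂, r₃, hr, s₀, s₁, s₂, s₃, hs, q₀, q₁, q₂, q₃, hq⟩ :=
    exists_basis_bool a b c d e f h a' b' c' d' e' f' h' h''
  refine ⟨bit2 r₀, bit2 r₁, bit2 r₂, bit2 r₃, ?_, bit2 s₀, bit2 s₁, bit2 s₂, bit2 s₃, ?_,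
    bit2 q₀, bit2 q₁, bit2 q₂, bit2 q₃, ?_⟩
  · simpa only [bf_bit2, bf_bit2', bit2_one, bit2_zero] using hr
  · simpa only [bf_bit2, bf_bit2', bit2_one, bit2_zero] using hs
  · simpa only [bf_bit2, bf_bit2', bit2_one, bit2_zero] using hq

lemma sg_eq : ∀ x : ZMod 2, sg x = 1 - 2 * (x.val : ℤ) := by decide
lemma sg_add_one : ∀ x : ZMod 2, sg (x + 1) = - sg x := by decide

lemma even_sum8 (a b c d e f g h : ZMod 2) (k : ℤ)
    (H : sg a + sg b + sg c + sg d + sg e + sg f + sg g + sg h = 4 * k) :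
    a + b + c + d + e + f + g + h = 0 := by
  simp only [sg_eq] at H
  have : ((a.val + b.val + c.val + d.val + e.val + f.val + g.val + h.val : ℕ) : ZMod 2) = 0 := by
    rw [ZMod.natCast_eq_zero_iff]; omega
  simpa using this

lemma abs_four {x : ℤ} (h : |x| = 4) : x = 4 ∨ x = -4 := eq_or_eq_neg_of_abs_eq h

lemma mk_four {A B W : ℤ} (hA : A = 4 ∨ A = -4) (hB : B = 4 ∨ B = -4) (h : A + B = 2 * W) :
    ∃ k : ℤ, W = 4 * k := by
  rcases hA with hA | hA <;> rcases hB with hB | hB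
  exacts [⟨1, by linarith⟩, ⟨0, by linarith⟩, ⟨0, by linarith⟩, ⟨-1, by linarith⟩]

lemma mk_four' {A B W : ℤ} (hA : A = 4 ∨ A = -4) (hB : B = 4 ∨ B = -4) (h : A - B = 2 * W) :
    ∃ k : ℤ, W = 4 * k :=
  mk_four (B := -B) hA (by rcases hB with h | h <;> simp [h]) (by linarith)

/-- Coefficients of bent functions. -/
lemma bent_form (G : ZMod 2 → ZMod 2 → ZMod 2 → ZMod 2 → ZMod 2) (h : Bent4 G) :
    let a := G 0 0 0 0 + G 1 0 0 0 + G 0 1 0 0 + G 1 1 0 0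
    let b := G 0 0 0 0 + G 1 0 0 0 + G 0 0 1 0 + G 1 0 1 0
    let c := G 0 0 0 0 + G 1 0 0 0 + G 0 0 0 1 + G 1 0 0 1
    let d := G 0 0 0 0 + G 0 1 0 0 + G 0 0 1 0 + G 0 1 1 0
    let e := G 0 0 0 0 + G 0 1 0 0 + G 0 0 0 1 + G 0 1 0 1
    let f := G 0 0 0 0 + G 0 0 1 0 + G 0 0 0 1 + G 0 0 1 1
    (∀ x y z t, G x y z t = qf a b c d e f x y z t + (G 0 0 0 0
      + ((G 0 0 0 0 + G 1 0 0 0) * x + (G 0 0 0 0 + G 0 1 0 0) * y + (G 0 0 0 0 + G 0 0 1 0) * z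
        + (G 0 0 0 0 + G 0 0 0 1) * t))) ∧
    pf a b c d e f = 1 := by
  intro a b c d e f
  have key : ∀ x y z t, G x y z t = qf a b c d e f x y z t + (G 0 0 0 0
      + ((G 0 0 0 0 + G 1 0 0 0) * x + (G 0 0 0 0 + G 0 1 0 0) * y + (G 0 0 0 0 + G 0 0 1 0) * z
        + (G 0 0 0 0 + G 0 0 0 1) * t)) := by
    have h0 := abs_four (h 0 0 0 0)
    have h1 := abs_four (h 1 0 0 0)
    have h2 := abs_four (h 0 1 0 0)
    have h3 := abs_four (h 0 0 1 0)
    have h4 := abs_four (h 0 0 0 1)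
    simp only [S4, mul_zero, mul_one, add_zero, zero_add, sg_add_one] at h0 h1 h2 h3 h4
    have e1 := even_sum8 (G 0 0 0 0) (G 0 0 0 1) (G 0 0 1 0) (G 0 0 1 1)
      (G 0 1 0 0) (G 0 1 0 1) (G 0 1 1 0) (G 0 1 1 1)
    have e2 := even_sum8 (G 0 0 0 0) (G 0 0 0 1) (G 0 0 1 0) (G 0 0 1 1)
      (G 1 0 0 0) (G 1 0 0 1) (G 1 0 1 0) (G 1 0 1 1)
    have e3 := even_sum8 (G 0 0 0 0) (G 0 0 0 1) (G 0 1 0 0) (G 0 1 0 1)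
      (G 1 0 0 0) (G 1 0 0 1) (G 1 1 0 0) (G 1 1 0 1)
    have e4 := even_sum8 (G 0 0 0 0) (G 0 1 0 0) (G 0 0 1 0) (G 0 1 1 0)
      (G 1 0 0 0) (G 1 1 0 0) (G 1 0 1 0) (G 1 1 1 0)
    have e5 := even_sum8 (G 1 0 0 0) (G 1 0 0 1) (G 1 0 1 0) (G 1 0 1 1)
      (G 1 1 0 0) (G 1 1 0 1) (G 1 1 1 0) (G 1 1 1 1)
    have e1 := (mk_four h0 h1 (by ring)).elim e1
    have e2 := (mk_four h0 h2 (by ring)).elim e2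
    have e3 := (mk_four h0 h3 (by ring)).elim e3
    have e4 := (mk_four h0 h4 (by ring)).elim e4
    have e5 := (mk_four' h0 h1 (by ring)).elim e5
    clear h0 h1 h2 h3 h4 h
    have z2 : ∀ x : ZMod 2, x = 0 ∨ x = 1 := by decide
    intro x y z t
    rcases z2 x with rfl | rfl <;> rcases z2 y with rfl | rfl <;> rcases z2 z with rfl | rfl <;>
      rcases z2 t with rfl | rfl <;> simp only [qf, a, b, c, d, e, f] <;> grind
  refine ⟨key, pf_of_sum (G 0 0 0 0) _ _ _ _ _ _ ?_⟩
  rw [← h (G 0 0 0 0 + G 1 0 0 0) (G 0 0 0 0 + G 0 1 0 0) (G 0 0 0 0 + G 0 0 1 0)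
    (G 0 0 0 0 + G 0 0 0 1)]
  congr 2
  funext x y z t
  congr 1
  rw [key x y z t, add_assoc, add_assoc, CharTwo.add_self_eq_zero, add_zero]

lemma qf_comb (a b c d e f : ZMod 2) (p₀ p₁ p₂ p₃ q₀ q₁ q₂ q₃ r₀ r₁ r₂ r₃ s₀ s₁ s₂ s₃ x y z t : ZMod 2) :
    qf a b c d e f (x*p₀+y*q₀+z*r₀+t*s₀) (x*p₁+y*q₁+z*r₁+t*s₁) (x*p₂+y*q₂+z*r₂+t*s₂)
      (x*p₃+y*q₃+z*r₃+t*s₃) =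
    qf (bf a b c d e f p₀ p₁ p₂ p₃ q₀ q₁ q₂ q₃) (bf a b c d e f p₀ p₁ p₂ p₃ r₀ r₁ r₂ r₃)
      (bf a b c d e f p₀ p₁ p₂ p₃ s₀ s₁ s₂ s₃) (bf a b c d e f q₀ q₁ q₂ q₃ r₀ r₁ r₂ r₃)
      (bf a b c d e f q₀ q₁ q₂ q₃ s₀ s₁ s₂ s₃) (bf a b c d e f r₀ r₁ r₂ r₃ s₀ s₁ s₂ s₃) x y z t
    + (qf a b c d e f p₀ p₁ p₂ p₃ * x + qf a b c d e f q₀ q₁ q₂ q₃ * y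
      + qf a b c d e f r₀ r₁ r₂ r₃ * z + qf a b c d e f s₀ s₁ s₂ s₃ * t) := by
  have z2 : ∀ x : ZMod 2, x = 0 ∨ x = 1 := by decide
  rcases z2 x with rfl | rfl <;> rcases z2 y with rfl | rfl <;> rcases z2 z with rfl | rfl <;>
      rcases z2 t with rfl | rfl <;> simp only [qf, bf] <;> ring

lemma S4_eq_sum (G : ZMod 2 → ZMod 2 → ZMod 2 → ZMod 2 → ℤ) :
    S4 G = ∑ v : Fin 4 → ZMod 2, G (v 0) (v 1) (v 2) (v 3) := by
  have key : ∀ H : ZMod 2 → ℤ, ∑ x : ZMod 2, H x = H 0 + H 1 := fun H => Fin.sum_univ_two H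
  rw [← (Fin.consEquiv (fun _ : Fin 4 => ZMod 2)).sum_comp, Fintype.sum_prod_type, key]
  simp only [← (Fin.consEquiv (fun _ : Fin 3 => ZMod 2)).sum_comp, Fintype.sum_prod_type, key,
    ← (Fin.consEquiv (fun _ : Fin 2 => ZMod 2)).sum_comp,
    ← (Fin.consEquiv (fun _ : Fin 1 => ZMod 2)).sum_comp]
  simp [S4, Fin.consEquiv]
  rfl

abbrev K := GaloisField 2 (2*2)

lemma exists_tr_s14 (φ : K →ₗ[ZMod 2] ZMod 2) : ∃ w : K, ∀ x, tr 2 (w * x) = φ x := by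
  have h := traceForm_nondegenerate (ZMod 2) K
  obtain ⟨w, hw⟩ := (LinearMap.BilinForm.toDual _ h).surjective φ
  refine ⟨w, fun x => ?_⟩
  rw [← hw, LinearMap.BilinForm.toDual_def]
  rfl

lemma exists_coord : Nonempty (K ≃ₗ[ZMod 2] (Fin 4 → ZMod 2)) := by
  refine FiniteDimensional.nonempty_linearEquiv_of_finrank_eq ?_
  rw [GaloisField.finrank 2 (by norm_num)]
  simp

lemma code_comp (f g : Fin 2 → K → ZMod 2) (σ : K →ₗ[ZMod 2] K)
    (H : ∀ i, (fun x => f i (σ x)) ∈ code 2 2 g) (c : K → ZMod 2) (hc : c ∈ code 2 2 f) :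
    (fun x => c (σ x)) ∈ code 2 2 g := by
  unfold code at hc
  induction hc using Submodule.span_induction with
  | mem x hx =>
    rcases hx with (⟨i, rfl⟩ | ⟨w, rfl⟩) | rfl
    · exact H i
    · obtain ⟨w', hw'⟩ := exists_tr_s14 (((Algebra.trace (ZMod 2) K).comp (LinearMap.mulLeft (ZMod 2) w)).comp σ)
      refine Submodule.subset_span (Or.inl (Or.inr ⟨w', ?_⟩))
      funext x
      exact hw' x
    · exact Submodule.subset_span (Or.inr rfl)
  | zero => exact Submodule.zero_mem _
  | add x y _ _ hx hy => exact Submodule.add_mem _ hx hy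
  | smul a x _ hx => exact Submodule.smul_mem _ a hx

/-- Standard pair. -/
def std : Fin 2 → (Fin 4 → ZMod 2) → ZMod 2 :=
  ![fun v => qf 0 1 0 0 1 0 (v 0) (v 1) (v 2) (v 3), fun v => qf 0 0 1 1 1 0 (v 0) (v 1) (v 2) (v 3)]

lemma affine_mem (g : Fin 2 → K → ZMod 2) (φ : K →ₗ[ZMod 2] ZMod 2) (c : ZMod 2) :
    (fun x => φ x + c) ∈ code 2 2 g := by
  obtain ⟨w, hw⟩ := exists_tr_s14 φ
  have h1 : (fun x => tr 2 (w * x)) ∈ code 2 2 g := Submodule.subset_span (Or.inl (Or.inr ⟨w, rfl⟩))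
  have h2 : (fun _ => 1 : K → ZMod 2) ∈ code 2 2 g := Submodule.subset_span (Or.inr rfl)
  convert Submodule.add_mem _ h1 (Submodule.smul_mem _ c h2) using 1
  funext x
  simp [hw x]

lemma bent4_of_bent (F : K → ZMod 2) (e : K ≃ₗ[ZMod 2] (Fin 4 → ZMod 2)) (h : IsBent 2 F) :
    Bent4 (fun x y z t => F (e.symm ![x, y, z, t])) := by
  intro l m n k
  let ψ : (Fin 4 → ZMod 2) →ₗ[ZMod 2] ZMod 2 := l • LinearMap.proj 0 + m • LinearMap.proj 1 +
    n • LinearMap.proj 2 + k • LinearMap.proj 3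
  obtain ⟨w, hw⟩ := exists_tr_s14 (ψ.comp e.toLinearMap)
  have := h w
  rw [S4_eq_sum, ← e.toEquiv.sum_comp]
  rw [show (4 : ℤ) = 2 ^ 2 by norm_num, ← this]
  congr 1
  refine Finset.sum_congr rfl fun x _ => ?_
  have hv : ∀ v : Fin 4 → ZMod 2, ![v 0, v 1, v 2, v 3] = v := by
    intro v; funext i; fin_cases i <;> rfl
  simp only [hv, sg, hw]
  simp [ψ]

set_option maxHeartbeats 1000000 in
lemma normal_form (f : Fin 2 → K → ZMod 2) (hf : IsBentVectorial 2 2 f) :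
    ∃ τ : (Fin 4 → ZMod 2) ≃ₗ[ZMod 2] K, ∃ φ : Fin 2 → ((Fin 4 → ZMod 2) →ₗ[ZMod 2] ZMod 2),
      ∃ c : Fin 2 → ZMod 2, ∀ i v, f i (τ v) = std i v + (φ i v + c i) := by
  obtain ⟨e⟩ := exists_coord
  have b0 : IsBent 2 (f 0) := by
    have := hf ![1, 0] (by decide)
    simpa using this
  have b1 : IsBent 2 (f 1) := by
    have := hf ![0, 1] (by decide)
    simpa using this
  have b2 : IsBent 2 (fun x => f 0 x + f 1 x) := by
    have := hf ![1, 1] (by decide)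
    simpa using this
  obtain ⟨k0, p0⟩ := bent_form _ (bent4_of_bent _ e b0)
  obtain ⟨k1, p1⟩ := bent_form _ (bent4_of_bent _ e b1)
  obtain ⟨-, p2⟩ := bent_form _ (bent4_of_bent _ e b2)
  obtain ⟨G0, g0⟩ : ∃ G0 : ZMod 2 → ZMod 2 → ZMod 2 → ZMod 2 → ZMod 2,
    ∀ x y z t, f 0 (e.symm ![x, y, z, t]) = G0 x y z t := ⟨_, fun _ _ _ _ => rfl⟩
  obtain ⟨G1, g1⟩ : ∃ G1 : ZMod 2 → ZMod 2 → ZMod 2 → ZMod 2 → ZMod 2,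
    ∀ x y z t, f 1 (e.symm ![x, y, z, t]) = G1 x y z t := ⟨_, fun _ _ _ _ => rfl⟩
  simp only [g0, g1] at k0 k1 p0 p1 p2
  obtain ⟨r₀, r₁, r₂, r₃, ⟨h1, h1'⟩, s₀, s₁, s₂, s₃, ⟨h2, h2', h3, h3'⟩, q₀, q₁, q₂, q₃,
    h4, h4', h5, h5', h6, h6'⟩ := exists_basis _ _ _ _ _ _ p0 _ _ _ _ _ _ p1
      (by refine Eq.trans ?_ p2; congr 1 <;> ring)
  clear p2 p0 p1 b0 b1 b2
  generalize G0 0 0 0 0 + G0 1 0 0 0 + G0 0 1 0 0 + G0 1 1 0 0 = A01 at *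
  generalize G0 0 0 0 0 + G0 1 0 0 0 + G0 0 0 1 0 + G0 1 0 1 0 = A02 at *
  generalize G0 0 0 0 0 + G0 1 0 0 0 + G0 0 0 0 1 + G0 1 0 0 1 = A03 at *
  generalize G0 0 0 0 0 + G0 0 1 0 0 + G0 0 0 1 0 + G0 0 1 1 0 = A12 at *
  generalize G0 0 0 0 0 + G0 0 1 0 0 + G0 0 0 0 1 + G0 0 1 0 1 = A13 at *
  generalize G0 0 0 0 0 + G0 0 0 1 0 + G0 0 0 0 1 + G0 0 0 1 1 = A23 at *
  generalize G1 0 0 0 0 + G1 1 0 0 0 + G1 0 1 0 0 + G1 1 1 0 0 = B01 at *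
  generalize G1 0 0 0 0 + G1 1 0 0 0 + G1 0 0 1 0 + G1 1 0 1 0 = B02 at *
  generalize G1 0 0 0 0 + G1 1 0 0 0 + G1 0 0 0 1 + G1 1 0 0 1 = B03 at *
  generalize G1 0 0 0 0 + G1 0 1 0 0 + G1 0 0 1 0 + G1 0 1 1 0 = B12 at *
  generalize G1 0 0 0 0 + G1 0 1 0 0 + G1 0 0 0 1 + G1 0 1 0 1 = B13 at *
  generalize G1 0 0 0 0 + G1 0 0 1 0 + G1 0 0 0 1 + G1 0 0 1 1 = B23 at *
  let M : (Fin 4 → ZMod 2) →ₗ[ZMod 2] (Fin 4 → ZMod 2) :=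
    (LinearMap.proj 0).smulRight ![1, 0, 0, 0] + (LinearMap.proj 1).smulRight ![q₀, q₁, q₂, q₃] +
    (LinearMap.proj 2).smulRight ![r₀, r₁, r₂, r₃] + (LinearMap.proj 3).smulRight ![s₀, s₁, s₂, s₃]
  have hM : ∀ v, M v = ![v 0 * 1 + v 1 * q₀ + v 2 * r₀ + v 3 * s₀,
      v 0 * 0 + v 1 * q₁ + v 2 * r₁ + v 3 * s₁, v 0 * 0 + v 1 * q₂ + v 2 * r₂ + v 3 * s₂,
      v 0 * 0 + v 1 * q₃ + v 2 * r₃ + v 3 * s₃] := by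
    intro v
    simp [M]
  have inj : Function.Injective M := by
    rw [← LinearMap.ker_eq_bot, LinearMap.ker_eq_bot']
    intro v hv
    rw [hM] at hv
    have c0 := congrFun hv 0
    have c1 := congrFun hv 1
    have c2 := congrFun hv 2
    have c3 := congrFun hv 3
    simp only [Matrix.cons_val, Pi.zero_apply] at c0 c1 c2 c3
    have two : (2 : ZMod 2) = 0 := rfl
    have L : ∀ x y z t, bf A01 A02 A03 A12 A13 A23 (v 0 * 1 + v 1 * q₀ + v 2 * r₀ + v 3 * s₀)
      (v 0 * 0 + v 1 * q₁ + v 2 * r₁ + v 3 * s₁) (v 0 * 0 + v 1 * q₂ + v 2 * r₂ + v 3 * s₂)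
      (v 0 * 0 + v 1 * q₃ + v 2 * r₃ + v 3 * s₃) x y z t = 0 := by
      intro x y z t
      rw [c0, c1, c2, c3]
      simp [bf]
    have L0 := L r₀ r₁ r₂ r₃
    have L1 := L s₀ s₁ s₂ s₃
    have L2 := L 1 0 0 0
    have L3 := L q₀ q₁ q₂ q₃
    clear L c0 c1 c2 c3 hv hM h1' h2' h3' h4' h5' h6' k0 k1 g0 g1
    simp only [bf] at *
    funext i
    fin_cases i
    · show v 0 = 0
      linear_combination L0 - v 0 * h1 - v 1 * h5 + v 3 * h3 - (v 3 * (A01*(r₀*s₁+r₁*s₀) + A02*(r₀*s₂+r₂*s₀) + A03*(r₀*s₃+r₃*s₀) + A12*(r₁*s₂+r₂*s₁)+A13*(r₁*s₃+r₃*s₁)+A23*(r₂*s₃+r₃*s₂)) + v 2 * (A01*r₀*r₁+A02*r₀*r₂+A03*r₀*r₃+A12*r₁*r₂+A13*r₁*r₃+A23*r₂*r₃)) * two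
    · show v 1 = 0
      clear two
      grind
    · show v 2 = 0
      clear two
      grind
    · show v 3 = 0
      clear two
      grind
  obtain ⟨E, hE⟩ : ∃ E : (Fin 4 → ZMod 2) ≃ₗ[ZMod 2] (Fin 4 → ZMod 2), ∀ v, E v = M v :=
    ⟨LinearEquiv.ofInjectiveEndo M inj, fun v => rfl⟩
  clear_value M
  obtain ⟨ψ, hψ⟩ : ∃ ψ : ZMod 2 → ZMod 2 → ZMod 2 → ZMod 2 → ((Fin 4 → ZMod 2) →ₗ[ZMod 2] ZMod 2),
      ∀ l m n k v, ψ l m n k v = l * v 0 + m * v 1 + n * v 2 + k * v 3 :=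
    ⟨fun l m n k => l • LinearMap.proj 0 + m • LinearMap.proj 1 + n • LinearMap.proj 2 +
      k • LinearMap.proj 3, by intros; simp⟩
  refine ⟨E.trans e.symm, ![
    ψ (qf A01 A02 A03 A12 A13 A23 1 0 0 0) (qf A01 A02 A03 A12 A13 A23 q₀ q₁ q₂ q₃)
      (qf A01 A02 A03 A12 A13 A23 r₀ r₁ r₂ r₃) (qf A01 A02 A03 A12 A13 A23 s₀ s₁ s₂ s₃) +
    (ψ (G0 0 0 0 0 + G0 1 0 0 0) (G0 0 0 0 0 + G0 0 1 0 0) (G0 0 0 0 0 + G0 0 0 1 0)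
      (G0 0 0 0 0 + G0 0 0 0 1)).comp M,
    ψ (qf B01 B02 B03 B12 B13 B23 1 0 0 0) (qf B01 B02 B03 B12 B13 B23 q₀ q₁ q₂ q₃)
      (qf B01 B02 B03 B12 B13 B23 r₀ r₁ r₂ r₃) (qf B01 B02 B03 B12 B13 B23 s₀ s₁ s₂ s₃) +
    (ψ (G1 0 0 0 0 + G1 1 0 0 0) (G1 0 0 0 0 + G1 0 1 0 0) (G1 0 0 0 0 + G1 0 0 1 0)
      (G1 0 0 0 0 + G1 0 0 0 1)).comp M], ![G0 0 0 0 0, G1 0 0 0 0], ?_⟩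
  intro i v
  fin_cases i
  · have hs : std 0 v = qf 0 1 0 0 1 0 (v 0) (v 1) (v 2) (v 3) := rfl
    simp only [Fin.zero_eta, Fin.mk_one, Matrix.cons_val_zero, Matrix.cons_val_one, LinearMap.add_apply,
      LinearMap.comp_apply, LinearEquiv.trans_apply]
    rw [hs, hE, hψ, hψ, hM, g0, k0, qf_comb, h1, h2, h3, h4, h5, h6]
    simp only [Matrix.cons_val]
    ring
  · have hs : std 1 v = qf 0 0 1 1 1 0 (v 0) (v 1) (v 2) (v 3) := rfl
    simp only [Fin.zero_eta, Fin.mk_one, Matrix.cons_val_zero, Matrix.cons_val_one, LinearMap.add_apply,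
      LinearMap.comp_apply, LinearEquiv.trans_apply]
    rw [hs, hE, hψ, hψ, hM, g1, k1, qf_comb, h1', h2', h3', h4', h5', h6']
    simp only [Matrix.cons_val]
    ring

lemma transfer (f g : Fin 2 → K → ZMod 2) (τ ρ : (Fin 4 → ZMod 2) ≃ₗ[ZMod 2] K)
    (φ χ : Fin 2 → ((Fin 4 → ZMod 2) →ₗ[ZMod 2] ZMod 2)) (c d : Fin 2 → ZMod 2)
    (hτ : ∀ i v, f i (τ v) = std i v + (φ i v + c i))
    (hρ : ∀ i v, g i (ρ v) = std i v + (χ i v + d i)) (i : Fin 2) :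
    (fun x => f i ((ρ.symm.trans τ) x)) ∈ code 2 2 g := by
  have h1 : g i ∈ code 2 2 g := Submodule.subset_span (Or.inl (Or.inl ⟨i, rfl⟩))
  have h2 := affine_mem g ((φ i - χ i).comp ρ.symm.toLinearMap) (c i - d i)
  convert Submodule.add_mem _ h1 h2 using 1
  funext x
  have e1 := hρ i (ρ.symm x)
  rw [LinearEquiv.apply_symm_apply] at e1
  simp only [LinearEquiv.trans_apply, Pi.add_apply, hτ, e1, LinearMap.comp_apply,
    LinearMap.sub_apply, LinearEquiv.coe_coe]
  ring

/-- any two `[16, 7, 6]` codes obtained from `(4, 2)` bent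
vectorial functions on `GF(2^4)` are equivalent. -/
theorem stmt_14 (f g : Fin 2 → GaloisField 2 (2*2) → ZMod 2)
    (hf : IsBentVectorial 2 2 f) (hg : IsBentVectorial 2 2 g) :
    ∃ σ : Equiv.Perm (GaloisField 2 (2*2)),
      (fun c => c ∘ σ) '' (code 2 2 f : Set (GaloisField 2 (2*2) → ZMod 2)) =
        (code 2 2 g : Set (GaloisField 2 (2*2) → ZMod 2)) := by
  obtain ⟨τ, φ, c, hτ⟩ := normal_form f hf
  obtain ⟨ρ, χ, d, hρ⟩ := normal_form g hg
  refine ⟨(ρ.symm.trans τ).toEquiv, ?_⟩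
  ext h
  constructor
  · rintro ⟨h, hh, rfl⟩
    exact code_comp f g (ρ.symm.trans τ).toLinearMap (transfer f g τ ρ φ χ c d hτ hρ) h hh
  · intro hh
    refine ⟨_, code_comp g f (τ.symm.trans ρ).toLinearMap (transfer g f ρ τ χ φ d c hρ hτ) h hh, ?_⟩
    funext x
    simp
end
end
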